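/- arXiv:1311.4770 — 2 statements merged into one kernel-verified Lean document; each statement's English description precedes it below -/
import Mathlib

section
/- Let V be a real vector space of finite dimension at least 2 and let L : V \ {0} → ℝ be a smooth function that is positively homogeneous of degree 2 and satisfies L(v) > 0 for every v ≠ 0. If the fundamental tensor g_v of L is nondegenerate for every v ≠ 0, then g_v is positive definite for every v ≠ 0. -/
/-- The fundamental tensor of a (pseudo-)Finsler-type Lagrangian `L` at a vector `v`:
`g_v(u,w) = (1/2) · ∂²/∂t∂s L(v + t u + s w)|_{t=s=0}`, i.e. one half of the second
derivative of `L` at `v`, evaluated on the pair `(u, w)`. -/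
noncomputable def fundTensor {V : Type*} [NormedAddCommGroup V] [NormedSpace ℝ V]
    (L : V → ℝ) (v u w : V) : ℝ :=
  (1 / 2) * fderiv ℝ (fderiv ℝ L) v u w

open Filter Topology

/-- A bilinear form that is symmetric and positive semidefinite is positive on every nonzero vector
as soon as it is nondegenerate. -/
lemma pos_of_nonneg_of_nondegenerate {V : Type*} [NormedAddCommGroup V] [NormedSpace ℝ V]
    (B : V →L[ℝ] V →L[ℝ] ℝ) (hsymm : ∀ u w, B u w = B w u) (hnonneg : ∀ u, 0 ≤ B u u)
    (hnondeg : ∀ u, (∀ w, B u w = 0) → u = 0) (u : V) (hu : u ≠ 0) : 0 < B u u := by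
  refine lt_of_le_of_ne (hnonneg u) fun h0 => hu (hnondeg u fun w => ?_)
  by_contra hb
  have h := hnonneg (w + (-(B w w + 1) / (2 * B u w)) • u)
  simp only [map_add, map_smul, add_apply, smul_apply, smul_eq_mul, hsymm w u, ← h0] at h
  have : -(B w w + 1) / (2 * B u w) * B u w = -(B w w + 1) / 2 := by field_simp
  linarith

/-- Positivity on nonzero vectors is an open condition on bilinear forms on a finite-dimensional
space. -/
lemma eventually_pos_of_pos {X V : Type*} [TopologicalSpace X] [NormedAddCommGroup V]
    [NormedSpace ℝ V] [FiniteDimensional ℝ V] (B : X → V →L[ℝ] V →L[ℝ] ℝ) (x : X)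
    (hB : ContinuousAt B x) (hpos : ∀ u, u ≠ 0 → 0 < B x u u) :
    ∀ᶠ y in 𝓝 x, ∀ u, u ≠ 0 → 0 < B y u u := by
  have hK : IsCompact (Metric.sphere (0 : V) 1) := isCompact_sphere 0 1
  have h : ∀ᶠ y in 𝓝 x, ∀ u ∈ Metric.sphere (0 : V) 1, 0 < B y u u := by
    refine hK.eventually_forall_of_forall_eventually fun u hu => ?_
    have hc : ContinuousAt (fun p : X × V => B p.1 p.2 p.2) (x, u) := by
      have h1 : ContinuousAt (fun p : X × V => B p.1) (x, u) :=
        ContinuousAt.comp (f := Prod.fst) (x := (x, u)) hB continuousAt_fst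
      exact (h1.clm_apply continuousAt_snd).clm_apply continuousAt_snd
    exact hc.eventually (lt_mem_nhds (hpos u (ne_zero_of_mem_unit_sphere ⟨u, hu⟩)))
  filter_upwards [h] with y hy u hu
  have hn : ‖u‖ ≠ 0 := norm_ne_zero_iff.mpr hu
  have h1 := hy (‖u‖⁻¹ • u) (by simp [norm_smul, hn])
  simp only [map_smul, smul_apply, smul_eq_mul] at h1
  have h2 : 0 < ‖u‖⁻¹ := by positivity
  exact (mul_pos_iff_of_pos_left h2).mp ((mul_pos_iff_of_pos_left h2).mp h1)

/-- The second derivative at a local minimum is nonnegative. -/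
lemma deriv_deriv_nonneg_of_isLocalMin {f : ℝ → ℝ} {x : ℝ} (h : IsLocalMin f x)
    (hf : ContinuousAt f x) : 0 ≤ deriv (deriv f) x := by
  by_contra! hneg
  have hmax : IsLocalMax f x := isLocalMax_of_deriv_deriv_neg hneg h.deriv_eq_zero hf
  have hconst : f =ᶠ[𝓝 x] fun _ => f x := by
    filter_upwards [h, hmax] with y h1 h2 using le_antisymm h2 h1
  have h2 := hconst.deriv.deriv_eq
  simp at h2
  linarith

/-- A positive, positively 2-homogeneous function which is twice continuously differentiable away
from the origin has a positive definite second derivative at some nonzero vector. -/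
lemma exists_fderiv_fderiv_pos {V : Type*} [NormedAddCommGroup V] [NormedSpace ℝ V]
    [FiniteDimensional ℝ V] [Nontrivial V] (L : V → ℝ)
    (hsmooth : ∀ v, v ≠ 0 → ContDiffAt ℝ 2 L v)
    (hhom : ∀ c : ℝ, 0 < c → ∀ v : V, v ≠ 0 → L (c • v) = c ^ 2 * L v)
    (hpos : ∀ v : V, v ≠ 0 → 0 < L v) :
    ∃ v, v ≠ 0 ∧ ∀ u, u ≠ 0 → 0 < fderiv ℝ (fderiv ℝ L) v u u := by
  obtain ⟨A⟩ : Nonempty (V ≃L[ℝ] EuclideanSpace ℝ (Fin (Module.finrank ℝ V))) := ⟨toEuclidean⟩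
  have hne : ∀ x ∈ Metric.sphere (0 : V) 1, x ≠ 0 := fun x hx =>
    ne_zero_of_mem_unit_sphere ⟨x, hx⟩
  obtain ⟨v, hvs, hv⟩ := (isCompact_sphere (0 : V) 1).exists_isMaxOn
    (NormedSpace.sphere_nonempty.mpr zero_le_one) (f := fun x => ‖A x‖ ^ 2 / L x)
    (fun x hx => ((A.continuous.norm.pow 2).continuousAt.div
      (hsmooth x (hne x hx)).continuousAt (hpos x (hne x hx)).ne').continuousWithinAt)
  have hv0 := hne v hvs
  set C := ‖A v‖ ^ 2 / L v with hC
  have hAv : 0 < ‖A v‖ := norm_pos_iff.mpr (by simpa using hv0)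
  have hCpos : 0 < C := div_pos (by positivity) (hpos v hv0)
  have hbound : ∀ x, x ≠ 0 → ‖A x‖ ^ 2 ≤ C * L x := by
    intro x hx
    have hn : 0 < ‖x‖ := norm_pos_iff.mpr hx
    have h1 : ‖A (‖x‖⁻¹ • x)‖ ^ 2 / L (‖x‖⁻¹ • x) ≤ C :=
      hv (show ‖x‖⁻¹ • x ∈ Metric.sphere (0 : V) 1 by simp [norm_smul, hn.ne'])
    rw [hhom _ (inv_pos.mpr hn) x hx, map_smul, norm_smul, mul_pow, Real.norm_eq_abs, sq_abs,
      mul_div_mul_left _ _ (by positivity), div_le_iff₀ (hpos x hx)] at h1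
    exact h1
  refine ⟨v, hv0, fun u hu => ?_⟩
  have hline : ∀ t : ℝ, HasDerivAt (fun t : ℝ => v + t • u) u t := fun t => by
    simpa using ((hasDerivAt_id t).smul_const u).const_add v
  have hnear : ∀ᶠ t : ℝ in 𝓝 0, v + t • u ≠ 0 :=
    (hline 0).continuousAt.eventually_ne (by simpa using hv0)
  obtain ⟨b, hsq⟩ : ∃ b : ℝ, ∀ t : ℝ,
      ‖A (v + t • u)‖ ^ 2 = ‖A v‖ ^ 2 + 2 * b * t + ‖A u‖ ^ 2 * t ^ 2 := by
    refine ⟨inner ℝ (A v) (A u), fun t => ?_⟩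
    rw [map_add, map_smul, norm_add_sq_real, inner_smul_right, norm_smul, mul_pow,
      Real.norm_eq_abs, sq_abs]
    ring
  let φ : ℝ → ℝ := fun t =>
    C * L (v + t • u) - (‖A v‖ ^ 2 + 2 * b * t + ‖A u‖ ^ 2 * t ^ 2)
  have hmin : IsLocalMin φ 0 := by
    filter_upwards [hnear] with t ht
    have h0 : φ 0 = 0 := by
      simp [φ, hC, (hpos v hv0).ne']
    rw [h0]
    have := hbound _ ht
    rw [hsq] at this
    exact sub_nonneg.mpr this
  have hφ' : ∀ t : ℝ, v + t • u ≠ 0 → HasDerivAt φ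
      (C * fderiv ℝ L (v + t • u) u - (2 * b + ‖A u‖ ^ 2 * (2 * t))) t := by
    intro t ht
    have h1 := ((hsmooth _ ht).differentiableAt (by norm_num)).hasFDerivAt.comp_hasDerivAt t
      (hline t)
    have h2 : HasDerivAt (fun t : ℝ => ‖A v‖ ^ 2 + 2 * b * t + ‖A u‖ ^ 2 * t ^ 2)
        (2 * b + ‖A u‖ ^ 2 * (2 * t)) t := by
      have h3 := (((hasDerivAt_id t).const_mul (2 * b)).const_add (‖A v‖ ^ 2)).add
        ((hasDerivAt_pow 2 t).const_mul (‖A u‖ ^ 2))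
      exact h3.congr_deriv (by simp)
    exact (h1.const_mul C).sub h2
  have hφ'' : HasDerivAt (fun t : ℝ =>
      C * fderiv ℝ L (v + t • u) u - (2 * b + ‖A u‖ ^ 2 * (2 * t)))
      (C * fderiv ℝ (fderiv ℝ L) v u u - 2 * ‖A u‖ ^ 2) 0 := by
    have hd : DifferentiableAt ℝ (fderiv ℝ L) (v + (0 : ℝ) • u) := by
      simpa using ((hsmooth v hv0).fderiv_right (m := 1) (by norm_num)).differentiableAt
        (by norm_num)
    have h0 : HasDerivAt (fun t : ℝ => fderiv ℝ L (v + t • u))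
        (fderiv ℝ (fderiv ℝ L) (v + (0 : ℝ) • u) u) 0 :=
      hd.hasFDerivAt.comp_hasDerivAt (0 : ℝ) (hline 0)
    have h1 : HasDerivAt (fun t : ℝ => fderiv ℝ L (v + t • u) u)
        (fderiv ℝ (fderiv ℝ L) v u u) 0 := by
      simpa using h0.clm_apply (hasDerivAt_const (0 : ℝ) u)
    have h2 : HasDerivAt (fun t : ℝ => 2 * b + ‖A u‖ ^ 2 * (2 * t)) (2 * ‖A u‖ ^ 2) 0 := by
      have h3 := (((hasDerivAt_id (0 : ℝ)).const_mul 2).const_mul (‖A u‖ ^ 2)).const_add (2 * b)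
      exact h3.congr_deriv (by ring)
    exact (h1.const_mul C).sub h2
  have h := deriv_deriv_nonneg_of_isLocalMin hmin
    (hφ' 0 (by simpa using hv0)).continuousAt
  have hderiv : deriv φ =ᶠ[𝓝 0] fun t =>
      C * fderiv ℝ L (v + t • u) u - (2 * b + ‖A u‖ ^ 2 * (2 * t)) :=
    hnear.mono fun t ht => (hφ' t ht).deriv
  rw [hderiv.deriv_eq, hφ''.deriv] at h
  have hAu : 0 < ‖A u‖ := norm_pos_iff.mpr (by simpa using hu)
  have : 0 < C * fderiv ℝ (fderiv ℝ L) v u u := by nlinarith [pow_pos hAu 2]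
  exact (mul_pos_iff_of_pos_left hCpos).mp this

/-- If `L` is a smooth positively 2-homogeneous function on `V \ {0}` with `L > 0`
(on a real vector space of finite dimension at least 2) whose fundamental tensor is
nondegenerate at every `v ≠ 0`, then the fundamental tensor is positive definite at
every `v ≠ 0`. -/
theorem positive_definite_of_nondegenerate
    {V : Type*} [NormedAddCommGroup V] [NormedSpace ℝ V] [FiniteDimensional ℝ V]
    (hdim : 2 ≤ Module.finrank ℝ V)
    (L : V → ℝ)
    (hsmooth : ContDiffOn ℝ (⊤ : ℕ∞) L {v : V | v ≠ 0})
    (hhom : ∀ c : ℝ, 0 < c → ∀ v : V, v ≠ 0 → L (c • v) = c ^ 2 * L v)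
    (hpos : ∀ v : V, v ≠ 0 → 0 < L v)
    (hnondeg : ∀ v : V, v ≠ 0 → ∀ u : V, (∀ w : V, fundTensor L v u w = 0) → u = 0) :
    ∀ v : V, v ≠ 0 → ∀ u : V, u ≠ 0 → 0 < fundTensor L v u u := by
  have hcd : ∀ v : V, v ≠ 0 → ContDiffAt ℝ 2 L v := fun v hv =>
    ((hsmooth v hv).contDiffAt (isOpen_ne.mem_nhds hv)).of_le (WithTop.coe_le_coe.mpr (le_top (a := (2 : ℕ∞))))
  have hcont : ∀ v : V, v ≠ 0 → ContinuousAt (fderiv ℝ (fderiv ℝ L)) v := fun v hv =>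
    (((hcd v hv).fderiv_right (m := 1) (by norm_num)).fderiv_right (m := 0)
      (by norm_num)).continuousAt
  have hsymm : ∀ v : V, v ≠ 0 → ∀ u w : V,
      fderiv ℝ (fderiv ℝ L) v u w = fderiv ℝ (fderiv ℝ L) v w u := fun v hv u w =>
    ((hcd v hv).isSymmSndFDerivAt (by simp)).eq u w
  have : Nontrivial V := Module.nontrivial_of_finrank_pos (R := ℝ) (by omega)
  have hrank : 1 < Module.rank ℝ V := by
    rw [← Module.finrank_eq_rank]
    exact_mod_cast hdim
  have hconn : IsPreconnected ({0}ᶜ : Set V) :=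
    (isConnected_compl_singleton_of_one_lt_rank hrank 0).isPreconnected
  let P : Set V := {v | v ≠ 0 ∧ ∀ u, u ≠ 0 → 0 < fderiv ℝ (fderiv ℝ L) v u u}
  have hopen : IsOpen P := isOpen_iff_mem_nhds.mpr fun v hv =>
    Filter.inter_mem (isOpen_ne.mem_nhds hv.1) (eventually_pos_of_pos _ v (hcont v hv.1) hv.2)
  obtain ⟨v₀, hv₀⟩ := exists_fderiv_fderiv_pos L hcd hhom hpos
  have hsub : ({0}ᶜ : Set V) ⊆ P := by
    refine hconn.subset_of_closure_inter_subset hopen ⟨v₀, hv₀.1, hv₀⟩ ?_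
    rintro v ⟨hcl, hv⟩
    refine ⟨hv, pos_of_nonneg_of_nondegenerate _ (hsymm v hv) (fun u => ?_) fun u hu =>
      hnondeg v hv u fun w => by simp [fundTensor, hu w]⟩
    have hc : ContinuousAt (fun x => fderiv ℝ (fderiv ℝ L) x u u) v :=
      ((hcont v hv).clm_apply continuousAt_const).clm_apply continuousAt_const
    by_contra! hneg
    obtain ⟨x, hx, hxP⟩ := mem_closure_iff_nhds.mp hcl _ (hc.eventually (gt_mem_nhds hneg))
    have hu : u ≠ 0 := by
      rintro rfl
      simp at hneg
    exact lt_asymm hx (hxP.2 u hu)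
  intro v hv u hu
  exact mul_pos (by norm_num) ((hsub hv).2 u hu)
end

section
/- Let V be a finite-dimensional real vector space and L : V \ {0} → ℝ a smooth function that is positively homogeneous of degree 2, satisfies L(v) > 0 for all v ≠ 0, and whose fundamental tensor is positive definite at every v ≠ 0 (i.e. L is the square of a Finsler metric on V). Define F(v) = √(L(v)) for v ≠ 0 and F(0) = 0. Then F is subadditive: F(u + w) ≤ F(u) + F(w) for all u, w ∈ V; in particular the unit ball {v : F(v) ≤ 1} bounded by the indicatrix of F is convex. -/
/-- A `C²` function whose second derivative is nonnegative along a segment is convex along it. -/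
theorem le_combo_of_fderiv_fderiv_nonneg {V : Type*} [NormedAddCommGroup V] [NormedSpace ℝ V]
    {L : V → ℝ} {x y : V} (hL : ∀ t ∈ Set.Icc (0 : ℝ) 1, ContDiffAt ℝ 2 L (y + t • (x - y)))
    (hnonneg : ∀ t ∈ Set.Icc (0 : ℝ) 1,
      0 ≤ fderiv ℝ (fderiv ℝ L) (y + t • (x - y)) (x - y) (x - y))
    {t : ℝ} (ht : t ∈ Set.Icc (0 : ℝ) 1) :
    L (y + t • (x - y)) ≤ t * L x + (1 - t) * L y := by
  have hline : ∀ s : ℝ, HasDerivAt (fun s : ℝ => y + s • (x - y)) (x - y) s := fun s => by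
    simpa using ((hasDerivAt_id s).smul_const (x - y)).const_add y
  have hderiv : ∀ s ∈ Set.Icc (0 : ℝ) 1, HasDerivAt (fun s : ℝ => L (y + s • (x - y)))
      (fderiv ℝ L (y + s • (x - y)) (x - y)) s := fun s hs =>
    HasFDerivAt.comp_hasDerivAt (l := L) s
      ((hL s hs).differentiableAt two_ne_zero).hasFDerivAt (hline s)
  have hderiv2 : ∀ s ∈ Set.Icc (0 : ℝ) 1,
      HasDerivAt (fun s : ℝ => fderiv ℝ L (y + s • (x - y)) (x - y))
        (fderiv ℝ (fderiv ℝ L) (y + s • (x - y)) (x - y) (x - y)) s := fun s hs => by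
    have hd : DifferentiableAt ℝ (fderiv ℝ L) (y + s • (x - y)) :=
      ((hL s hs).fderiv_right (m := 1) (by norm_num)).differentiableAt (by norm_num)
    have hcomp : HasDerivAt (fun s : ℝ => fderiv ℝ L (y + s • (x - y)))
        (fderiv ℝ (fderiv ℝ L) (y + s • (x - y)) (x - y)) s :=
      HasFDerivAt.comp_hasDerivAt (l := fderiv ℝ L) s hd.hasFDerivAt (hline s)
    simpa using hcomp.clm_apply (hasDerivAt_const s (x - y))
  have hconv : ConvexOn ℝ (Set.Icc (0 : ℝ) 1) (fun s : ℝ => L (y + s • (x - y))) :=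
    convexOn_of_hasDerivWithinAt2_nonneg (convex_Icc 0 1)
      (fun s hs => (hderiv s hs).continuousAt.continuousWithinAt)
      (fun s hs => (hderiv s (interior_subset hs)).hasDerivWithinAt)
      (fun s hs => (hderiv2 s (interior_subset hs)).hasDerivWithinAt)
      (fun s hs => hnonneg s (interior_subset hs))
  have h := hconv.2 (Set.right_mem_Icc.2 zero_le_one) (Set.left_mem_Icc.2 zero_le_one)
    ht.1 (sub_nonneg.2 ht.2) (add_sub_cancel t 1)
  simpa using h


/-- If `L` is smooth on `V \ {0}`, positively homogeneous of degree 2, positive and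
has positive definite fundamental tensor at every `v ≠ 0` (i.e. `L` is the square of
a Finsler metric on `V`), then `F = √L` (extended by `F(0) = 0`) is subadditive:
`F(u + w) ≤ F(u) + F(w)`; in particular the unit ball `{v : F v ≤ 1}` bounded by the
indicatrix of `F` is convex. -/
theorem finsler_triangle_inequality
    {V : Type*} [NormedAddCommGroup V] [NormedSpace ℝ V] [FiniteDimensional ℝ V]
    (L : V → ℝ)
    (hsmooth : ContDiffOn ℝ (⊤ : ℕ∞) L {v : V | v ≠ 0})
    (hhom : ∀ c : ℝ, 0 < c → ∀ v : V, v ≠ 0 → L (c • v) = c ^ 2 * L v)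
    (hpos : ∀ v : V, v ≠ 0 → 0 < L v)
    (hpd : ∀ v : V, v ≠ 0 → ∀ u : V, u ≠ 0 → 0 < fundTensor L v u u)
    (F : V → ℝ)
    (hF0 : F 0 = 0)
    (hF : ∀ v : V, v ≠ 0 → F v = Real.sqrt (L v)) :
    (∀ u w : V, F (u + w) ≤ F u + F w) ∧ Convex ℝ {v : V | F v ≤ 1} := by
  have hFpos : ∀ v, v ≠ 0 → 0 < F v := fun v hv => by
    rw [hF v hv]; exact Real.sqrt_pos.2 (hpos v hv)
  have hFnonneg : ∀ v, 0 ≤ F v := fun v => by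
    rcases eq_or_ne v 0 with rfl | hv
    · exact hF0.ge
    · exact (hFpos v hv).le
  have hFsq : ∀ v, v ≠ 0 → F v ^ 2 = L v := fun v hv => by
    rw [hF v hv, Real.sq_sqrt (hpos v hv).le]
  have hFsmul : ∀ c : ℝ, 0 ≤ c → ∀ v, F (c • v) = c * F v := fun c hc v => by
    rcases hc.eq_or_lt with rfl | hc
    · simp [hF0]
    rcases eq_or_ne v 0 with rfl | hv
    · simp [hF0]
    rw [hF _ (smul_ne_zero hc.ne' hv), hhom c hc v hv, hF v hv, Real.sqrt_mul (sq_nonneg c),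
      Real.sqrt_sq hc.le]
  have hopp : ∀ c : ℝ, 0 < c → ∀ w, F (-c • w + w) ≤ F (-c • w) + F w := fun c hc w => by
    rcases le_total c 1 with h | h
    · rw [show -c • w + w = (1 - c) • w by module, hFsmul _ (sub_nonneg.2 h)]
      nlinarith [hFnonneg w, hFnonneg (-c • w)]
    · rw [show -c • w + w = (1 - c⁻¹) • (-c • w) by
          match_scalars; field_simp; ring,
        hFsmul _ (sub_nonneg.2 (inv_le_one_of_one_le₀ h))]
      nlinarith [hFnonneg w, mul_nonneg (inv_nonneg.2 hc.le) (hFnonneg (-c • w))]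
  have hsub : ∀ u w : V, F (u + w) ≤ F u + F w := fun u w => by
    rcases eq_or_ne u 0 with rfl | hu
    · simp [hF0]
    rcases eq_or_ne w 0 with rfl | hw
    · simp [hF0]
    by_cases hray : ∃ c : ℝ, 0 < c ∧ u = -c • w
    · obtain ⟨c, hc, rfl⟩ := hray
      exact hopp c hc w
    have ha := hFpos u hu
    have hb := hFpos w hw
    set a := F u with ha_def
    set b := F w with hb_def
    have hs : 0 < a + b := add_pos ha hb
    set x := ((a + b) / a) • u with hx
    set y := ((a + b) / b) • w with hy
    have hne : ∀ t ∈ Set.Icc (0 : ℝ) 1, y + t • (x - y) ≠ 0 := by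
      rintro t ⟨ht0, ht1⟩ h
      have h' : (t * ((a + b) / a)) • u + ((1 - t) * ((a + b) / b)) • w = 0 := by
        rw [← h, hx, hy]; module
      rcases ht0.eq_or_lt with rfl | ht0
      · simp [hw, hs.ne', hb.ne'] at h'
      rcases ht1.eq_or_lt with rfl | ht1
      · simp [hu, hs.ne', ha.ne'] at h'
      have hp : 0 < t * ((a + b) / a) := by positivity
      have hq : 0 < (1 - t) * ((a + b) / b) := mul_pos (sub_pos.2 ht1) (by positivity)
      refine hray ⟨_, div_pos hq hp, ?_⟩
      rw [← smul_right_inj hp.ne', eq_neg_of_add_eq_zero_left h', smul_smul, ← neg_smul]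
      congr 1
      field_simp
    have ht : a / (a + b) ∈ Set.Icc (0 : ℝ) 1 :=
      ⟨by positivity, (div_le_one hs).2 (by linarith)⟩
    have hcombo := le_combo_of_fderiv_fderiv_nonneg (L := L) (x := x) (y := y)
      (fun t ht => (hsmooth.contDiffAt (isOpen_ne.mem_nhds (hne t ht))).of_le
        (WithTop.coe_le_coe.2 le_top))
      (fun t ht => by
        rcases eq_or_ne (x - y) 0 with h | h
        · simp [h]
        · have := hpd _ (hne t ht) _ h
          unfold fundTensor at this
          linarith) ht
    have hxy : y + (a / (a + b)) • (x - y) = u + w := by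
      rw [hx, hy]
      match_scalars <;> field_simp
      ring
    have hLx : L x = (a + b) ^ 2 := by
      rw [hx, hhom _ (by positivity) u hu, ← hFsq u hu, ← ha_def]
      field_simp
    have hLy : L y = (a + b) ^ 2 := by
      rw [hy, hhom _ (by positivity) w hw, ← hFsq w hw, ← hb_def]
      field_simp
    have huw : u + w ≠ 0 := hxy ▸ hne _ ht
    rw [hxy, hLx, hLy, ← hFsq _ huw] at hcombo
    exact (sq_le_sq₀ (hFnonneg _) hs.le).1 (by linarith)
  refine ⟨hsub, fun u hu w hw a b ha hb hab => ?_⟩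
  simp only [Set.mem_ofPred_eq] at hu hw ⊢
  calc F (a • u + b • w) ≤ a * F u + b * F w := by
        simpa only [hFsmul a ha, hFsmul b hb] using hsub (a • u) (b • w)
    _ ≤ 1 := by nlinarith
end
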